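/- arXiv:2405.10341 — 8 statements merged into one kernel-verified Lean document; each statement's English description precedes it below -/
import Mathlib

section
/- For all real numbers a, b > 0 satisfying a + b ≥ π, one has |sin a · sin b| / (a·b) ≤ 4/π². -/
open Real

theorem Real.mul_sin_le_mul_sin_of_le {x y : ℝ} (hx : 0 ≤ x) (hxy : x ≤ y) (hy : 0 < y)
    (hyπ : y ≤ π) : x * sin y ≤ y * sin x := by
  have h := strictConcaveOn_sin_Icc.concaveOn.2 (Set.left_mem_Icc.2 pi_pos.le)
    (Set.mem_Icc.2 ⟨hy.le, hyπ⟩) (sub_nonneg.2 ((div_le_one hy).2 hxy))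
    (div_nonneg hx hy.le) (sub_add_cancel 1 (x / y))
  simp only [smul_eq_mul, sin_zero, mul_zero, zero_add, div_mul_cancel₀ x hy.ne'] at h
  calc x * sin y = y * (x / y * sin y) := by field_simp
    _ ≤ y * sin x := mul_le_mul_of_nonneg_left h hy.le

theorem Real.pi_sq_mul_sin_sq_le {x : ℝ} (hx : 0 ≤ x) (hxπ : x ≤ π) :
    π ^ 2 * sin x ^ 2 ≤ 4 * (x * (π - x)) := by
  have ht : |π / 2 - x| ≤ π / 2 := abs_le.2 ⟨by linarith, by linarith⟩
  have h : 2 * |π / 2 - x| ≤ π * sin |π / 2 - x| := by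
    have := mul_le_mul_of_nonneg_left (mul_le_sin (abs_nonneg _) ht) pi_pos.le
    rwa [← mul_assoc, mul_div_cancel₀ _ pi_ne_zero] at this
  have h2 := pow_le_pow_left₀ (by positivity) h 2
  rw [mul_pow, mul_pow, sq_abs, sin_sq, cos_abs, cos_pi_div_two_sub] at h2
  linarith

theorem Real.abs_sin_mul_sin_div_le_of_pi_le {x y : ℝ} (hx : 0 < x) (hy : π ≤ y) :
    |sin x * sin y| / (x * y) ≤ 4 / π ^ 2 := by
  have hy0 : 0 < y := pi_pos.trans_le hy
  have h : |sin x * sin y| ≤ x := by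
    rw [abs_mul]
    have hsx : |sin x| ≤ x := (abs_sin_le_abs (x := x)).trans_eq (abs_of_pos hx)
    exact (mul_le_of_le_one_right (abs_nonneg _) (abs_sin_le_one y)).trans hsx
  calc |sin x * sin y| / (x * y) ≤ x / (x * y) := by gcongr
    _ = 1 / y := by field_simp
    _ ≤ 1 / π := one_div_le_one_div_of_le pi_pos hy
    _ = π / π ^ 2 := by field_simp
    _ ≤ 4 / π ^ 2 := by gcongr; exact pi_le_four

/-- For all positive reals `a, b` with `a + b ≥ π`, one has `|sin a · sin b|/(a·b) ≤ 4/π²`. -/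
theorem stmt1 (a b : ℝ) (ha : 0 < a) (hb : 0 < b) (hab : π ≤ a + b) :
    |Real.sin a * Real.sin b| / (a * b) ≤ 4 / π ^ 2 := by
  rcases le_or_gt π b with hbπ | hbπ
  · exact abs_sin_mul_sin_div_le_of_pi_le ha hbπ
  rcases le_or_gt π a with haπ | haπ
  · rw [mul_comm (sin a), mul_comm a]
    exact abs_sin_mul_sin_div_le_of_pi_le hb haπ
  have hsa : 0 < sin a := sin_pos_of_pos_of_lt_pi ha haπ
  have hsb : 0 < sin b := sin_pos_of_pos_of_lt_pi hb hbπ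
  have hc : 0 < π - a := sub_pos.2 haπ
  have h1 : (π - a) * sin b ≤ b * sin a := by
    simpa only [sin_pi_sub] using mul_sin_le_mul_sin_of_le hc.le (by linarith) hb hbπ.le
  rw [abs_of_pos (mul_pos hsa hsb), div_le_div_iff₀ (mul_pos ha hb) (by positivity)]
  refine le_of_mul_le_mul_right ?_ hc
  calc sin a * sin b * π ^ 2 * (π - a) = sin a * π ^ 2 * ((π - a) * sin b) := by ring
    _ ≤ sin a * π ^ 2 * (b * sin a) := by gcongr
    _ = b * (π ^ 2 * sin a ^ 2) := by ring
    _ ≤ b * (4 * (a * (π - a))) :=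
      mul_le_mul_of_nonneg_left (pi_sq_mul_sin_sq_le ha.le haπ.le) hb.le
    _ = 4 * (a * b) * (π - a) := by ring
end

section
/- For every a ∈ (0, π) one has sin²(a) ≤ (4/π²) · a · (π − a), with equality when a = π/2. Equivalently, the function g(a) = sin²(a)/(a(π − a)) on (0, π) attains its maximum value 4/π² at a = π/2. -/
open Real

/-- For every `a ∈ (0, π)`, `sin² a ≤ (4/π²)·a·(π−a)`, with equality at `a = π/2`. -/
theorem stmt2 :
    (∀ a ∈ Set.Ioo (0:ℝ) π, Real.sin a ^ 2 ≤ 4 / π ^ 2 * (a * (π - a))) ∧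
      Real.sin (π / 2) ^ 2 = 4 / π ^ 2 * (π / 2 * (π - π / 2)) := by
  constructor
  · rintro a ⟨ha, ha'⟩
    have h := Real.cos_le_one_sub_mul_cos_sq (x := π - 2 * a)
      (abs_le.2 ⟨by linarith, by linarith⟩)
    rw [Real.cos_pi_sub, Real.cos_two_mul, Real.cos_sq'] at h
    have e : 1 - 2 / π ^ 2 * (π - 2 * a) ^ 2 = 2 * (4 / π ^ 2 * (a * (π - a))) - 1 := by
      field_simp
      ring
    linarith
  · rw [Real.sin_pi_div_two]
    field_simp
    ring
end

section
/- For every a ∈ (0, π) one has 1/a² + 1/(π − a)² < 2/sin²(a). (This expresses that the function g(a) = sin²(a)/(a(π−a)) is strictly log-concave on (0, π): (d²/da²) log g(a) = −2/sin²a + 1/a² + 1/(π−a)² < 0.) -/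
open Real

/-- For every `a ∈ (0, π)`, `1/a² + 1/(π−a)² < 2/sin² a`
(strict log-concavity of `sin² a / (a(π−a))` on `(0, π)`). -/
theorem stmt3 (a : ℝ) (ha : a ∈ Set.Ioo (0:ℝ) π) :
    1 / a ^ 2 + 1 / (π - a) ^ 2 < 2 / Real.sin a ^ 2 := by
  have one_div_sq_lt {x : ℝ} (hx : 0 < x) (hsin : 0 < sin x) :
      1 / x ^ 2 < 1 / sin x ^ 2 :=
    one_div_lt_one_div_of_lt (by positivity) (pow_lt_pow_left₀ (sin_lt hx) hsin.le two_ne_zero)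
  have hsin : 0 < sin a := sin_pos_of_mem_Ioo ha
  have h₁ := one_div_sq_lt ha.1 hsin
  have h₂ := one_div_sq_lt (sub_pos.2 ha.2) (by rwa [sin_pi_sub])
  rw [sin_pi_sub] at h₂
  calc 1 / a ^ 2 + 1 / (π - a) ^ 2 < 1 / sin a ^ 2 + 1 / sin a ^ 2 := add_lt_add h₁ h₂
    _ = 2 / sin a ^ 2 := by ring
end

section
/- Let r ≥ 1 be an integer and m > 0 a real number. Let f : ℝ^r → [0, ∞) be a measurable function with ∫_{ℝ^r} f(p) dp = 1, vanishing outside the closed unit ball, satisfying f(tp) ≥ f(p) for all p ∈ ℝ^r and t ∈ [0, 1] (radial monotonicity), and ∫_{ℝ^r} ‖p‖² f(p) dp ≥ m. Then for every L with 0 < L < m, sup_{p : ‖p‖² = L} f(p) ≥ (Γ(r/2) / (2 π^{r/2})) · (m − L). -/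
open Real MeasureTheory

/-- The unit ball of `ℝ^r` has volume at most the area of the unit sphere. -/
theorem volume_real_unit_closedBall_le (r : ℕ) (hr : 1 ≤ r) :
    volume.real (Metric.closedBall (0 : EuclideanSpace ℝ (Fin r)) 1) ≤
      2 * π ^ ((r : ℝ) / 2) / Real.Gamma ((r : ℝ) / 2) := by
  have : Nonempty (Fin r) := ⟨⟨0, hr⟩⟩
  have hr' : (1 : ℝ) ≤ r := by exact_mod_cast hr
  have hG : 0 < Real.Gamma ((r : ℝ) / 2) := Real.Gamma_pos_of_pos (by positivity)
  have hsqrt : √π ^ r = π ^ ((r : ℝ) / 2) := by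
    rw [Real.sqrt_eq_rpow, ← Real.rpow_natCast, ← Real.rpow_mul pi_pos.le]
    congr 1
    ring
  have hpos : 0 < π ^ ((r : ℝ) / 2) := Real.rpow_pos_of_pos pi_pos _
  rw [measureReal_def, EuclideanSpace.volume_closedBall, Fintype.card_fin, hsqrt,
    Real.Gamma_add_one (by positivity), ENNReal.ofReal_one, one_pow, one_mul,
    ENNReal.toReal_ofReal (by positivity), div_le_div_iff₀ (by positivity) hG]
  nlinarith [mul_le_mul_of_nonneg_right hr' (mul_pos hpos hG).le]

/-- A radially monotone function is bounded outside a ball by any bound on the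
bounding sphere. -/
theorem le_of_le_on_sphere {E : Type*} [NormedAddCommGroup E] [NormedSpace ℝ E] {f : E → ℝ}
    (hmono : ∀ p : E, ∀ t ∈ Set.Icc (0 : ℝ) 1, f p ≤ f (t • p)) {L S : ℝ} (hL : 0 < L)
    (hS : ∀ q : E, ‖q‖ ^ 2 = L → f q ≤ S) {p : E} (hp : L ≤ ‖p‖ ^ 2) : f p ≤ S := by
  have hp0 : 0 < ‖p‖ := by
    by_contra! h
    have : ‖p‖ = 0 := le_antisymm h (norm_nonneg p)
    rw [this] at hp
    linarith
  have hle : √L ≤ ‖p‖ := Real.sqrt_le_iff.mpr ⟨hp0.le, hp⟩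
  refine (hmono p (√L / ‖p‖) ⟨by positivity, (div_le_one hp0).mpr hle⟩).trans (hS _ ?_)
  rw [norm_smul, Real.norm_of_nonneg (by positivity), div_mul_cancel₀ _ hp0.ne',
    Real.sq_sqrt hL.le]

/-- Let `f : ℝ^r → [0,∞)` be a measurable probability density supported in the closed unit
ball, radially monotone (`f(tp) ≥ f(p)` for `t ∈ [0,1]`), with `∫ ‖p‖² f(p) dp ≥ m`. Then
for every `0 < L < m`, the supremum of `f` over the sphere `{‖p‖² = L}` is at least
`(Γ(r/2)/(2π^{r/2}))·(m − L)`. -/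
theorem stmt9 (r : ℕ) (hr : 1 ≤ r) (m : ℝ) (hm : 0 < m)
    (f : EuclideanSpace ℝ (Fin r) → ℝ) (hmeas : Measurable f) (hnn : ∀ p, 0 ≤ f p)
    (hint : ∫ p, f p = 1)
    (hball : ∀ p : EuclideanSpace ℝ (Fin r), 1 < ‖p‖ → f p = 0)
    (hmono : ∀ (p : EuclideanSpace ℝ (Fin r)), ∀ t ∈ Set.Icc (0:ℝ) 1, f p ≤ f (t • p))
    (hsec : m ≤ ∫ p, ‖p‖ ^ 2 * f p) :
    ∀ L : ℝ, 0 < L → L < m →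
      ENNReal.ofReal (Real.Gamma ((r : ℝ) / 2) / (2 * π ^ ((r : ℝ) / 2)) * (m - L)) ≤
        ⨆ p ∈ {p : EuclideanSpace ℝ (Fin r) | ‖p‖ ^ 2 = L}, ENNReal.ofReal (f p) := by
  intro L hL hLm
  by_contra! hlt
  have hG : 0 < Real.Gamma ((r : ℝ) / 2) := Real.Gamma_pos_of_pos (by positivity)
  have hpi : 0 < π ^ ((r : ℝ) / 2) := Real.rpow_pos_of_pos pi_pos _
  set T := ⨆ p ∈ {p : EuclideanSpace ℝ (Fin r) | ‖p‖ ^ 2 = L}, ENNReal.ofReal (f p)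
  have hT : T ≠ ⊤ := hlt.ne_top
  have hTlt : T.toReal < Real.Gamma ((r : ℝ) / 2) / (2 * π ^ ((r : ℝ) / 2)) * (m - L) :=
    (ENNReal.lt_ofReal_iff_toReal_lt hT).mp hlt
  have hT0 : 0 ≤ T.toReal := ENNReal.toReal_nonneg
  have hsphere : ∀ q : EuclideanSpace ℝ (Fin r), ‖q‖ ^ 2 = L → f q ≤ T.toReal := fun q hq ↦
    (ENNReal.ofReal_le_iff_le_toReal hT).mp
      (le_iSup₂ (f := fun p (_ : p ∈ {p : EuclideanSpace ℝ (Fin r) | ‖p‖ ^ 2 = L}) ↦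
        ENNReal.ofReal (f p)) q hq)
  have hf : Integrable f := by
    by_contra h
    rw [integral_undef h] at hint
    exact zero_ne_one hint
  have hsq : ∀ p : EuclideanSpace ℝ (Fin r), ‖p‖ ≤ 1 → ‖p‖ ^ 2 ≤ 1 := fun p hp ↦
    pow_le_one₀ (norm_nonneg p) hp
  have hf2 : Integrable fun p ↦ ‖p‖ ^ 2 * f p := by
    refine hf.mono' (by fun_prop) (ae_of_all _ fun p ↦ ?_)
    rw [Real.norm_of_nonneg (mul_nonneg (by positivity) (hnn p))]
    rcases le_or_gt ‖p‖ 1 with h | h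
    · exact mul_le_of_le_one_left (hnn p) (hsq p h)
    · simp [hball p h]
  have hlower : m - L ≤ ∫ p, (‖p‖ ^ 2 * f p - L * f p) := by
    rw [integral_sub hf2 (hf.const_mul L), integral_const_mul, hint]
    linarith
  have hfin : volume (Metric.closedBall (0 : EuclideanSpace ℝ (Fin r)) 1) ≠ ⊤ :=
    measure_closedBall_lt_top.ne
  have hupper : ∫ p, (‖p‖ ^ 2 * f p - L * f p) ≤
      volume.real (Metric.closedBall (0 : EuclideanSpace ℝ (Fin r)) 1) * T.toReal := by
    rw [← smul_eq_mul, ← integral_indicator_const _ Metric.isClosed_closedBall.measurableSet]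
    refine integral_mono (hf2.sub (hf.const_mul L))
      ((integrable_indicator_iff Metric.isClosed_closedBall.measurableSet).mpr
        (integrableOn_const hfin)) fun p ↦ ?_
    rcases le_or_gt ‖p‖ 1 with h | h
    · rw [Set.indicator_of_mem (by simpa using h)]
      rcases le_total L (‖p‖ ^ 2) with hp | hp
      · have hfp := le_of_le_on_sphere hmono hL hsphere hp
        nlinarith [hsq p h, hnn p]
      · nlinarith [hnn p]
    · rw [Set.indicator_of_notMem (by simpa using h)]
      simp [hball p h]
  have hvol := mul_le_mul_of_nonneg_right (volume_real_unit_closedBall_le r hr) hT0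
  have harea : 0 < 2 * π ^ ((r : ℝ) / 2) / Real.Gamma ((r : ℝ) / 2) := by positivity
  have hstrict := mul_lt_mul_of_pos_left hTlt harea
  have hcancel : 2 * π ^ ((r : ℝ) / 2) / Real.Gamma ((r : ℝ) / 2) *
      (Real.Gamma ((r : ℝ) / 2) / (2 * π ^ ((r : ℝ) / 2)) * (m - L)) = m - L := by
    field_simp
  linarith
end

section
/- Let r ≥ 1 be an integer, h a real number with h ≥ r + 1, and R ∈ (0, 1]. Let f : ℝ^r → [0, ∞) be a measurable function such that: ∫_{ℝ^r} f(p) dp = 1; f vanishes outside the closed unit ball; f is log-concave, i.e. f((1−t)x + ty) ≥ f(x)^{1−t} f(y)^t for all x, y and t ∈ [0,1]; f(p) ≥ f(q) whenever ‖p‖ ≤ R‖q‖; and ∫_{ℝ^r} ‖p‖² f(p) dp ≥ 1/(h+1). Set M := √(h+1)/R and D := inf_{b ∈ (0,1)} (M/b)^{1/(1−b)}. Then (π^{r/2} / Γ(r/2 + 1)) · f(0) ≤ 10^5 · r^{1/log M} · D^r. -/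
open Real MeasureTheory

/-- The critical-point equation of `b ↦ (L - log b) / (1 - b)` on `(0, 1)`. -/
lemma exists_critical_point {L : ℝ} (hL : 0 < L) :
    ∃ b ∈ Set.Ioo (0 : ℝ) 1, L - log b = 1 / b - 1 := by
  set a : ℝ := 1 / (2 * L + 4) ^ 2 with ha
  have ha0 : 0 < a := by positivity
  have ha1 : a < 1 := by
    rw [ha, div_lt_one (by positivity)]
    nlinarith
  have hcont : ContinuousOn (fun b : ℝ => 1 / b - 1 + log b) (Set.Icc a 1) := by
    intro b hb
    have hb0 : b ≠ 0 := (ha0.trans_le hb.1).ne'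
    exact ContinuousAt.continuousWithinAt (by fun_prop (disch := assumption))
  have hend : L ≤ 1 / a - 1 + log a := by
    have h1 : log (2 * L + 4) ≤ 2 * L + 4 - 1 := log_le_sub_one_of_pos (by positivity)
    have h2 : log a = -(2 * log (2 * L + 4)) := by
      rw [ha, one_div, log_inv, log_pow]
      norm_num
    have h3 : 1 / a = (2 * L + 4) ^ 2 := by rw [ha, one_div_one_div]
    rw [h2, h3]
    nlinarith
  obtain ⟨b, hb, hbL⟩ := intermediate_value_Icc' ha1.le hcont
    (show L ∈ Set.Icc _ _ from ⟨by simpa using hL.le, hend⟩)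
  have hbL' : 1 / b - 1 + log b = L := hbL
  refine ⟨b, ⟨ha0.trans_le hb.1, lt_of_le_of_ne hb.2 ?_⟩, by linarith⟩
  rintro rfl
  norm_num at hbL'
  linarith

/-- A critical point of `b ↦ (L - log b) / (1 - b)` is a global minimum on `(0, 1)`. -/
lemma exp_one_div_le_sInf {M b : ℝ} (hM : 0 < M) (hb : b ∈ Set.Ioo (0 : ℝ) 1)
    (hcrit : log M - log b = 1 / b - 1) :
    exp (1 / b) ≤ sInf ((fun b : ℝ => (M / b) ^ (1 / (1 - b))) '' Set.Ioo (0 : ℝ) 1) := by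
  refine le_csInf ⟨_, _, hb, rfl⟩ ?_
  rintro _ ⟨c, ⟨hc0, hc1⟩, rfl⟩
  have hb0 : 0 < b := hb.1
  have hlog : log (c / b) ≤ c / b - 1 := log_le_sub_one_of_pos (by positivity)
  rw [log_div hc0.ne' hb0.ne'] at hlog
  simp only
  rw [rpow_def_of_pos (by positivity), log_div hM.ne' hc0.ne', mul_one_div]
  refine exp_le_exp.2 ?_
  rw [le_div_iff₀ (by linarith)]
  have : 1 / b * (1 - c) = 1 / b - c / b := by ring
  linarith

/-- If the second moment of a density `f` on the unit ball exceeds `ρ² + c · vol`, then `f`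
exceeds `c` somewhere outside the ball of radius `ρ`. -/
lemma exists_lt_of_second_moment {E : Type*} [NormedAddCommGroup E] [NormedSpace ℝ E]
    [FiniteDimensional ℝ E] [MeasurableSpace E] [BorelSpace E] {μ : Measure E}
    [μ.IsAddHaarMeasure] {f : E → ℝ} (hnn : ∀ p, 0 ≤ f p) (hint : ∫ p, f p ∂μ = 1)
    (hball : ∀ p, 1 < ‖p‖ → f p = 0) {c ρ : ℝ} (hc : 0 ≤ c)
    (hsec : ρ ^ 2 + c * μ.real (Metric.closedBall 0 1) < ∫ p, ‖p‖ ^ 2 * f p ∂μ) :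
    ∃ q, ρ < ‖q‖ ∧ c < f q := by
  by_contra! hcon
  have hf : Integrable f μ := by
    by_contra hf
    simp [integral_undef hf] at hint
  have hind : Integrable ((Metric.closedBall (0 : E) 1).indicator fun _ => c) μ :=
    (integrable_indicator_iff Metric.isClosed_closedBall.measurableSet).2
      (integrableOn_const (measure_closedBall_lt_top).ne)
  have hle : ∫ p, ‖p‖ ^ 2 * f p ∂μ ≤
      ∫ p, ρ ^ 2 * f p + (Metric.closedBall (0 : E) 1).indicator (fun _ => c) p ∂μ := by
    refine integral_mono_of_nonneg (Filter.Eventually.of_forall fun p => ?_)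
      ((hf.const_mul _).add hind) (Filter.Eventually.of_forall fun p => ?_)
    · exact mul_nonneg (sq_nonneg _) (hnn p)
    · simp only
      by_cases hp : ‖p‖ ≤ 1
      · rw [Set.indicator_of_mem (by simpa using hp)]
        have hfp := hnn p
        by_cases hpρ : ρ < ‖p‖
        · have := hcon p hpρ
          have h1 : ‖p‖ ^ 2 ≤ 1 := pow_le_one₀ (norm_nonneg p) hp
          nlinarith [mul_nonneg (sq_nonneg ρ) hfp]
        · have : ‖p‖ ^ 2 ≤ ρ ^ 2 := pow_le_pow_left₀ (norm_nonneg p) (not_lt.1 hpρ) 2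
          nlinarith
      · rw [hball p (not_le.1 hp), Set.indicator_of_notMem (by simpa using hp)]
        simp
  rw [integral_add (hf.const_mul _) hind, integral_const_mul, hint,
    integral_indicator Metric.isClosed_closedBall.measurableSet, setIntegral_const,
    smul_eq_mul] at hle
  linarith

/-- A lower bound `v` of a density on the ball of radius `a`. -/
lemma pow_mul_measureReal_mul_le_one {E : Type*} [NormedAddCommGroup E] [NormedSpace ℝ E]
    [FiniteDimensional ℝ E] [MeasurableSpace E] [BorelSpace E] {μ : Measure E}
    [μ.IsAddHaarMeasure] {f : E → ℝ} (hnn : ∀ p, 0 ≤ f p) (hint : ∫ p, f p ∂μ = 1)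
    {a v : ℝ} (ha : 0 ≤ a) (hv : ∀ p, ‖p‖ ≤ a → v ≤ f p) :
    a ^ Module.finrank ℝ E * μ.real (Metric.closedBall 0 1) * v ≤ 1 := by
  have hf : Integrable f μ := by
    by_contra hf
    simp [integral_undef hf] at hint
  rw [← Measure.addHaar_real_closedBall' μ (0 : E) ha, ← smul_eq_mul, ← setIntegral_const, ← hint]
  calc ∫ _ in Metric.closedBall (0 : E) a, v ∂μ ≤ ∫ p in Metric.closedBall (0 : E) a, f p ∂μ :=
        setIntegral_mono_on (integrableOn_const (measure_closedBall_lt_top).ne) hf.integrableOn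
          Metric.isClosed_closedBall.measurableSet fun p hp => hv p (by simpa using hp)
    _ ≤ ∫ p, f p ∂μ := setIntegral_le_integral hf (Filter.Eventually.of_forall hnn)

lemma measureReal_euclidean_closedBall {r : ℕ} (hr : 1 ≤ r) :
    volume.real (Metric.closedBall (0 : EuclideanSpace ℝ (Fin r)) 1) =
      π ^ ((r : ℝ) / 2) / Real.Gamma ((r : ℝ) / 2 + 1) := by
  have : Nonempty (Fin r) := ⟨⟨0, hr⟩⟩
  rw [Measure.real, EuclideanSpace.volume_closedBall, Fintype.card_fin, ENNReal.ofReal_one,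
    one_pow, one_mul, ENNReal.toReal_ofReal]
  · rw [sqrt_eq_rpow, ← rpow_natCast, ← rpow_mul pi_pos.le]
    congr 2
    ring
  · exact div_nonneg (by positivity) (Gamma_pos_of_pos (by positivity)).le

/-- The final numerical estimate, deduced from the logarithm `hmass` of the mass inequality. -/
lemma le_of_log_mass_le {r : ℕ} (hr : 1 ≤ r) {A L H b D : ℝ} (hA : 0 < A) (hL : 1 / 2 ≤ L)
    (hH : H ≤ 2 * L) (hb : b ∈ Set.Ioo (0 : ℝ) 1) (hcrit : L - log b = 1 / b - 1)
    (hD : exp (1 / b) ≤ D)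
    (hmass : r * (-(log (1 + 1 / (r : ℝ)) / 2) + log b - L) + (1 - b) * log A -
      b * (log 2 + log ((r : ℝ) + 1) + H) ≤ 0) :
    A ≤ 10 ^ 5 * (r : ℝ) ^ (1 / L) * D ^ r := by
  obtain ⟨hb0, hb1⟩ := hb
  have hr1 : (1 : ℝ) ≤ r := by exact_mod_cast hr
  have hr0 : (0 : ℝ) < r := by linarith
  have hL0 : 0 < L := by linarith
  have h1b : 0 < 1 - b := by linarith
  have hs : r * log (1 + 1 / (r : ℝ)) ≤ 1 := by
    have := log_le_sub_one_of_pos (show 0 < 1 + 1 / (r : ℝ) by positivity)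
    calc r * log (1 + 1 / (r : ℝ)) ≤ r * (1 / (r : ℝ)) := by gcongr; linarith
      _ = 1 := by field_simp
  have hlr : 0 ≤ log (r : ℝ) := log_nonneg hr1
  have hlr1 : log ((r : ℝ) + 1) ≤ log 2 + log r := by
    rw [← log_mul (by norm_num) hr0.ne']
    exact log_le_log (by positivity) (by linarith)
  have hl2 : 0 < log 2 := log_pos (by norm_num)
  have hbL : b / (1 - b) ≤ 1 / L := by
    have hlb : log b < 0 := log_neg hb0 hb1
    have h1 : L ≤ (1 - b) / b := by
      rw [sub_div, div_self hb0.ne']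
      linarith
    rw [div_le_div_iff₀ h1b hL0]
    rw [le_div_iff₀ hb0] at h1
    linarith
  have hinv : 1 / L ≤ 2 := by rw [div_le_iff₀ hL0]; linarith
  have hlogA : log A ≤ r / b + (1 / (1 - b)) * (1 / 2) +
      b / (1 - b) * (2 * L + 2 * log 2 + log r) := by
    have key : (1 - b) * log A ≤ r * (1 / b - 1) + 1 / 2 + b * (2 * L + 2 * log 2 + log r) := by
      have : b * (log 2 + log ((r : ℝ) + 1) + H) ≤ b * (2 * L + 2 * log 2 + log r) :=
        mul_le_mul_of_nonneg_left (by linarith) hb0.le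
      rw [← hcrit]
      linarith
    rw [mul_comm, ← le_div_iff₀ h1b] at key
    refine key.trans_eq ?_
    field_simp
  have hfrac : 1 / (1 - b) = 1 + b / (1 - b) := by field_simp; ring
  have hmul : b / (1 - b) * (2 * L + 2 * log 2 + log r) ≤ 2 + 4 * log 2 + log r * (1 / L) := by
    calc b / (1 - b) * (2 * L + 2 * log 2 + log r)
        ≤ 1 / L * (2 * L + 2 * log 2 + log r) := by gcongr
      _ = 2 + 2 * log 2 * (1 / L) + log r * (1 / L) := by field_simp
      _ ≤ 2 + 2 * log 2 * 2 + log r * (1 / L) := by gcongr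
      _ = _ := by ring
  have hfin : log A ≤ (4 + 4 * log 2) + log r * (1 / L) + r * (1 / b) := by
    have : (r : ℝ) / b = r * (1 / b) := by ring
    linarith
  have hconst : exp (4 + 4 * log 2) ≤ 10 ^ 5 := by
    have h4 : exp (4 + 4 * log 2) = exp 1 ^ 4 * 2 ^ 4 := by
      rw [exp_add, ← exp_nat_mul]
      congr 1
      · norm_num
      · rw [show (4 : ℝ) * log 2 = ((4 : ℕ) : ℝ) * log 2 by norm_num, exp_nat_mul,
          exp_log (by norm_num)]
    have h3 : exp 1 ^ 4 ≤ 3 ^ 4 := by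
      gcongr
      exact exp_one_lt_three.le
    rw [h4]
    linarith
  calc A = exp (log A) := (exp_log hA).symm
    _ ≤ exp ((4 + 4 * log 2) + log r * (1 / L) + r * (1 / b)) := exp_le_exp.2 hfin
    _ = exp (4 + 4 * log 2) * (r : ℝ) ^ (1 / L) * exp (1 / b) ^ r := by
      rw [exp_add, exp_add, rpow_def_of_pos hr0, exp_nat_mul]
    _ ≤ 10 ^ 5 * (r : ℝ) ^ (1 / L) * D ^ r := by gcongr

/-- Upper bound of Theorem 3.4 for an abstract density carrying the properties of the
Duistermaat–Heckman function: if `f : ℝ^r → [0,∞)` is a measurable probability density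
supported in the closed unit ball, log-concave, satisfying `f(p) ≥ f(q)` whenever
`‖p‖ ≤ R‖q‖`, and `∫ ‖p‖² f ≥ 1/(h+1)` with `h ≥ r+1` and `R ∈ (0,1]`, then, setting
`M = √(h+1)/R` and `D = inf_{b∈(0,1)} (M/b)^{1/(1−b)}`, one has
`(π^{r/2}/Γ(r/2+1))·f(0) ≤ 10⁵·r^{1/log M}·D^r`. -/
theorem stmt11 (r : ℕ) (hr : 1 ≤ r) (h R : ℝ) (hh : (r : ℝ) + 1 ≤ h)
    (hR : R ∈ Set.Ioc (0 : ℝ) 1)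
    (f : EuclideanSpace ℝ (Fin r) → ℝ) (hmeas : Measurable f) (hnn : ∀ p, 0 ≤ f p)
    (hint : ∫ p, f p = 1)
    (hball : ∀ p : EuclideanSpace ℝ (Fin r), 1 < ‖p‖ → f p = 0)
    (hlc : ∀ x y : EuclideanSpace ℝ (Fin r), ∀ t ∈ Set.Icc (0:ℝ) 1,
      f x ^ (1 - t) * f y ^ t ≤ f ((1 - t) • x + t • y))
    (hmono : ∀ p q : EuclideanSpace ℝ (Fin r), ‖p‖ ≤ R * ‖q‖ → f q ≤ f p)
    (hsec : 1 / (h + 1) ≤ ∫ p, ‖p‖ ^ 2 * f p) :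
    π ^ ((r : ℝ) / 2) / Real.Gamma ((r : ℝ) / 2 + 1) * f 0 ≤
      10 ^ 5 * (r : ℝ) ^ (1 / Real.log (Real.sqrt (h + 1) / R)) *
        (sInf ((fun b : ℝ => (Real.sqrt (h + 1) / R / b) ^ (1 / (1 - b))) ''
          Set.Ioo (0:ℝ) 1)) ^ r := by
  obtain ⟨hR0, hR1⟩ := hR
  have hr1 : (1 : ℝ) ≤ r := by exact_mod_cast hr
  have hr0 : (0 : ℝ) < r := by linarith
  have hh0 : 0 < h + 1 := by linarith
  set M : ℝ := √(h + 1) / R with hM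
  have hsq : 0 < √(h + 1) := sqrt_pos.2 hh0
  have hM0 : 0 < M := by positivity
  have hH : log (h + 1) ≤ 2 * log M := by
    have hRlog : log R ≤ 0 := log_nonpos hR0.le hR1
    rw [hM, log_div hsq.ne' hR0.ne', log_sqrt hh0.le]
    linarith
  have hL : 1 / 2 ≤ log M := by
    have : 1 ≤ log (h + 1) := by
      rw [le_log_iff_exp_le hh0]
      linarith [exp_one_lt_three]
    linarith
  obtain ⟨b, hb, hcrit⟩ := exists_critical_point (show 0 < log M by linarith)
  have hb0 : 0 < b := hb.1
  set ω : ℝ := π ^ ((r : ℝ) / 2) / Real.Gamma ((r : ℝ) / 2 + 1) with hω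
  have hω0 : 0 < ω := div_pos (by positivity) (Gamma_pos_of_pos (by positivity))
  have hvol : volume.real (Metric.closedBall (0 : EuclideanSpace ℝ (Fin r)) 1) = ω :=
    measureReal_euclidean_closedBall hr
  set c : ℝ := 1 / (2 * (r + 1) * (h + 1)) / ω with hc
  have hc0 : 0 < c := by positivity
  have hT : 0 < 1 + 1 / (r : ℝ) := by positivity
  set s : ℝ := 1 / √(1 + 1 / (r : ℝ)) with hs
  have hs0 : 0 < s := by
    have := sqrt_pos.2 hT
    positivity
  have hs2 : s ^ 2 = r / (r + 1) := by
    rw [hs, div_pow, sq_sqrt hT.le]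
    field_simp
  obtain ⟨q, hq, hcq⟩ : ∃ q, s / √(h + 1) < ‖q‖ ∧ c < f q := by
    refine exists_lt_of_second_moment hnn hint hball hc0.le (lt_of_lt_of_le ?_ hsec)
    rw [hvol, hc, div_mul_cancel₀ _ hω0.ne', div_pow, sq_sqrt hh0.le, hs2, div_div,
      div_add_div _ _ (by positivity) (by positivity), div_lt_div_iff₀ (by positivity) hh0]
    have : 0 < (r + 1 : ℝ) * (h + 1) ^ 2 := by positivity
    nlinarith
  have hf0 : 0 < f 0 :=
    (hc0.trans hcq).trans_le (hmono 0 q (by rw [norm_zero]; positivity))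
  have hlow : ∀ p, ‖p‖ ≤ s / M * b → f 0 ^ (1 - b) * c ^ b ≤ f p := by
    intro p hp
    have hpq : ‖p‖ ≤ R * ‖b • q‖ := by
      rw [norm_smul, norm_of_nonneg hb0.le]
      refine hp.trans ?_
      have : s / M * b = R * (b * (s / √(h + 1))) := by rw [hM]; field_simp
      rw [this]
      gcongr
    have hseg := hlc 0 q b ⟨hb0.le, hb.2.le⟩
    rw [smul_zero, zero_add] at hseg
    calc f 0 ^ (1 - b) * c ^ b ≤ f 0 ^ (1 - b) * f q ^ b := by gcongr
      _ ≤ f (b • q) := hseg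
      _ ≤ f p := hmono _ _ hpq
  have hmass := pow_mul_measureReal_mul_le_one hnn hint (by positivity) hlow
  rw [hvol, finrank_euclideanSpace_fin] at hmass
  refine le_of_log_mass_le hr (by positivity) hL hH hb hcrit
    (exp_one_div_le_sInf hM0 hb hcrit) ?_
  have hlog := log_le_log (by positivity) hmass
  have hlogs : log s = -(log (1 + 1 / (r : ℝ)) / 2) := by
    rw [hs, one_div, log_inv, log_sqrt hT.le]
  have hlogc : log c = -(log 2 + log ((r : ℝ) + 1) + log (h + 1)) - log ω := by
    rw [hc, log_div (by positivity) hω0.ne', one_div, log_inv, log_mul (by positivity) hh0.ne',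
      log_mul (by norm_num) (by positivity)]
  rw [log_one, log_mul (by positivity) (by positivity), log_mul (by positivity) (by positivity),
    log_mul (by positivity) (by positivity), log_pow, log_mul (by positivity) (by positivity),
    log_div hs0.ne' hM0.ne', log_rpow hf0, log_rpow hc0, hlogs, hlogc] at hlog
  rw [log_mul hω0.ne' hf0.ne']
  linarith
end

section
/- For the upper incomplete Gamma function Γ(a, u) = ∫_u^∞ s^{a−1} e^{−s} ds and every integer d ≥ 8, there exist L ∈ (0, 1) and v ∈ (0, 1/3) such that [(1 − L)·(Γ(d/2) − Γ(d/2, dv/2)) − e^{−L/v}·Γ(d/2)] / Γ(d/2, dv/2) ≥ e^{−1}·(1 − e^{−1})^{d/2 + 1} / ((d/2 + 1)^{d/2 + 1} · (log(d/2 + 1))^{d/2}). -/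
open Real

/-- The upper incomplete Gamma function `Γ(a, u) = ∫_u^∞ s^{a−1} e^{−s} ds`. -/
noncomputable def upperIncGamma (a u : ℝ) : ℝ :=
  ∫ s in Set.Ioi u, s ^ (a - 1) * Real.exp (-s)

theorem upperIncGamma_le_Gamma_sub {a u : ℝ} (ha : 1 ≤ a) (hu : 0 ≤ u) :
    upperIncGamma a u ≤ Gamma a - exp (-u) * (u ^ a / a) := by
  have hint : MeasureTheory.IntegrableOn (fun s : ℝ => s ^ (a - 1) * exp (-s)) (Set.Ioi 0) := by
    simpa only [mul_comm] using GammaIntegral_convergent (s := a) (by linarith)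
  have hsplit : Gamma a =
      (∫ s in Set.Ioc 0 u, s ^ (a - 1) * exp (-s)) + upperIncGamma a u := by
    rw [Gamma_eq_integral (by linarith), upperIncGamma, ← MeasureTheory.setIntegral_union
      (Set.Ioc_disjoint_Ioi le_rfl) measurableSet_Ioi
      (hint.mono_set Set.Ioc_subset_Ioi_self) (hint.mono_set (Set.Ioi_subset_Ioi hu)),
      Set.Ioc_union_Ioi_eq_Ioi hu]
    simp only [mul_comm]
  have hpow : ∫ s in (0 : ℝ)..u, exp (-u) * s ^ (a - 1) = exp (-u) * (u ^ a / a) := by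
    rw [intervalIntegral.integral_const_mul, integral_rpow (Or.inl (by linarith)),
      sub_add_cancel, zero_rpow (by linarith), sub_zero]
  have hmono : exp (-u) * (u ^ a / a) ≤ ∫ s in Set.Ioc 0 u, s ^ (a - 1) * exp (-s) := by
    rw [← hpow, intervalIntegral.integral_of_le hu]
    refine MeasureTheory.setIntegral_mono_on ?_ (hint.mono_set Set.Ioc_subset_Ioi_self)
      measurableSet_Ioc fun s hs => ?_
    · rw [← intervalIntegrable_iff_integrableOn_Ioc_of_le hu]
      exact (intervalIntegral.intervalIntegrable_rpow' (by linarith)).const_mul _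
    · rw [mul_comm]
      exact mul_le_mul_of_nonneg_left (exp_le_exp.2 (neg_le_neg hs.2))
        (rpow_nonneg hs.1.le _)
  linarith

theorem upperIncGamma_pos {a u : ℝ} (ha : 0 < a) (hu : 0 ≤ u) : 0 < upperIncGamma a u := by
  have hint : MeasureTheory.IntegrableOn (fun s : ℝ => s ^ (a - 1) * exp (-s)) (Set.Ioi u) := by
    have h := GammaIntegral_convergent ha
    simp only [mul_comm] at h
    exact h.mono_set (Set.Ioi_subset_Ioi hu)
  have hpos : ∀ s ∈ Set.Ioi u, 0 < s ^ (a - 1) * exp (-s) := fun s hs =>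
    mul_pos (rpow_pos_of_pos (hu.trans_lt hs) _) (exp_pos _)
  rw [upperIncGamma, MeasureTheory.setIntegral_pos_iff_support_of_nonneg_ae
    ((MeasureTheory.ae_restrict_mem measurableSet_Ioi).mono fun s hs => (hpos s hs).le) hint,
    Set.inter_eq_right.2 fun s hs => Function.mem_support.2 (hpos s hs).ne']
  simp

theorem two_mul_mul_Gamma_le_rpow_self_succ {a : ℝ} (ha : 1 ≤ a)
    (h : 2 * a * Gamma (a + 1) ≤ a ^ a) :
    2 * (a + 1) * Gamma (a + 1 + 1) ≤ (a + 1) ^ (a + 1) := by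
  have ha0 : 0 < a := by linarith
  have hbern : 2 * a ^ a ≤ (a + 1) ^ a := by
    have h1 := one_add_mul_self_le_rpow_one_add (s := 1 / a)
      (by have : 0 < 1 / a := by positivity
          linarith) ha
    have h2 : (a + 1) ^ a = (1 + 1 / a) ^ a * a ^ a := by
      rw [← mul_rpow (by positivity) ha0.le]
      congr 1
      field_simp
    rw [h2]
    have h3 : 1 + a * (1 / a) = 2 := by field_simp; norm_num
    rw [h3] at h1
    gcongr
  have hG : 0 < Gamma (a + 1) := Gamma_pos_of_pos (by linarith)
  rw [Gamma_add_one (by linarith : a + 1 ≠ 0), rpow_add_one (by linarith : a + 1 ≠ 0)]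
  have : 2 * (a + 1) * Gamma (a + 1) ≤ (a + 1) ^ a := by nlinarith
  nlinarith

theorem two_mul_mul_Gamma_le_rpow_self (d : ℕ) (hd : 8 ≤ d) :
    2 * ((d : ℝ) / 2) * Gamma ((d : ℝ) / 2 + 1) ≤ ((d : ℝ) / 2) ^ ((d : ℝ) / 2) := by
  induction d using Nat.strong_induction_on with
  | _ d ih =>
    rcases lt_or_ge d 10 with h | h
    · interval_cases d
      · have h4 : ((8 : ℕ) : ℝ) / 2 = (4 : ℕ) := by norm_num
        rw [h4, Gamma_nat_eq_factorial, rpow_natCast]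
        norm_num [Nat.factorial]
      · have hG : Gamma (((9 : ℕ) : ℝ) / 2 + 1) ≤ 72 := by
          have h6 : Gamma 6 = 120 := by
            rw [show (6 : ℝ) = (5 : ℕ) + 1 by norm_num, Gamma_nat_eq_factorial]
            norm_num [Nat.factorial]
          have h5 : Gamma 5 = 24 := by
            rw [show (5 : ℝ) = (4 : ℕ) + 1 by norm_num, Gamma_nat_eq_factorial]
            norm_num [Nat.factorial]
          have hc := convexOn_Gamma.2 (Set.mem_Ioi.2 (by norm_num : (0 : ℝ) < 5))
            (Set.mem_Ioi.2 (by norm_num : (0 : ℝ) < 6))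
            (by norm_num : (0 : ℝ) ≤ 1 / 2) (by norm_num : (0 : ℝ) ≤ 1 / 2) (by norm_num)
          norm_num [h5, h6] at hc ⊢
          linarith
        have hp : (4.5 : ℝ) ^ (4 : ℕ) * 2 ≤ (4.5 : ℝ) ^ (4.5 : ℝ) := by
          have hs : (2 : ℝ) ≤ (4.5 : ℝ) ^ (1 / 2 : ℝ) := by
            rw [← sqrt_eq_rpow]
            exact le_sqrt_of_sq_le (by norm_num)
          calc (4.5 : ℝ) ^ (4 : ℕ) * 2 ≤ (4.5 : ℝ) ^ (4 : ℕ) * (4.5 : ℝ) ^ (1 / 2 : ℝ) := by gcongr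
            _ = (4.5 : ℝ) ^ ((4 : ℕ) + 1 / 2 : ℝ) := by
              rw [rpow_add (by norm_num), rpow_natCast]
            _ = _ := by norm_num
        have e : ((9 : ℕ) : ℝ) / 2 = 4.5 := by norm_num
        rw [e] at hG ⊢
        norm_num at hp hG ⊢
        linarith
    · obtain ⟨k, rfl⟩ : ∃ k, d = k + 2 := ⟨d - 2, by omega⟩
      have hk : (8 : ℝ) ≤ k := by exact_mod_cast (by omega : 8 ≤ k)
      have e : ((k + 2 : ℕ) : ℝ) / 2 = (k : ℝ) / 2 + 1 := by push_cast; ring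
      rw [e]
      exact two_mul_mul_Gamma_le_rpow_self_succ (by linarith) (ih k (by omega) (by omega))

theorem exp_neg_mul_log_div_le_rpow {b : ℝ} (hb : 1 < b) :
    exp (-(b * log b / (1 - exp (-1)))) ≤ ((1 - exp (-1)) / (b * log b)) ^ b := by
  have hl : 0 < log b := log_pos hb
  have hr : 0 < 1 - exp (-1) := by
    have : exp (-1) < 1 := exp_lt_one_iff.2 (by norm_num)
    linarith
  have hb0 : 0 < b := by linarith
  rw [rpow_def_of_pos (by positivity)]
  refine exp_le_exp.2 ?_
  have h := log_le_sub_one_of_pos (x := log b * exp (-1) / (1 - exp (-1))) (by positivity)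
  rw [log_div (by positivity) hr.ne', log_mul hl.ne' (exp_pos _).ne', log_exp] at h
  rw [log_div hr.ne' (by positivity), log_mul hb0.ne' hl.ne']
  have e : log b / (1 - exp (-1)) = log b * exp (-1) / (1 - exp (-1)) + log b := by
    field_simp
    ring
  rw [mul_div_assoc, e]
  nlinarith

/-- Analytic core of Theorem 1.1: for every `d ≥ 8` there exist `L ∈ (0,1)` and
`v ∈ (0,1/3)` such that
`[(1−L)(Γ(d/2) − Γ(d/2, dv/2)) − e^{−L/v} Γ(d/2)] / Γ(d/2, dv/2)`
is at least `e^{−1}(1−e^{−1})^{d/2+1} / ((d/2+1)^{d/2+1} (log(d/2+1))^{d/2})`. -/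
theorem stmt12 (d : ℕ) (hd : 8 ≤ d) :
    ∃ L ∈ Set.Ioo (0:ℝ) 1, ∃ v ∈ Set.Ioo (0:ℝ) (1/3),
      Real.exp (-1) * (1 - Real.exp (-1)) ^ ((d : ℝ) / 2 + 1) /
          (((d : ℝ) / 2 + 1) ^ ((d : ℝ) / 2 + 1) *
            Real.log ((d : ℝ) / 2 + 1) ^ ((d : ℝ) / 2)) ≤
        ((1 - L) * (Real.Gamma ((d : ℝ) / 2) - upperIncGamma ((d : ℝ) / 2) ((d : ℝ) / 2 * v)) -
            Real.exp (-(L / v)) * Real.Gamma ((d : ℝ) / 2)) /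
          upperIncGamma ((d : ℝ) / 2) ((d : ℝ) / 2 * v) := by
  set a : ℝ := (d : ℝ) / 2 with ha_def
  have ha : 4 ≤ a := by
    have : (8 : ℝ) ≤ d := by exact_mod_cast hd
    linarith
  have ha0 : 0 < a := by linarith
  have hR : 2 * a * Gamma (a + 1) ≤ a ^ a := two_mul_mul_Gamma_le_rpow_self d hd
  rw [Gamma_add_one ha0.ne'] at hR
  have hG : 0 < Gamma a := Gamma_pos_of_pos ha0
  have hl : 1.38 < log (a + 1) := by
    have h4 : log 4 = 2 * log 2 := by
      rw [show (4 : ℝ) = 2 ^ 2 by norm_num, log_pow]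
      norm_num
    have := log_le_log (by norm_num) (by linarith : (4 : ℝ) ≤ a + 1)
    have := log_two_gt_d9
    linarith
  have hla : log (a + 1) ≤ a := by
    have := log_le_sub_one_of_pos (by linarith : 0 < a + 1)
    linarith
  have hkey := exp_neg_mul_log_div_le_rpow (by linarith : 1 < a + 1)
  have he : exp 1 < 2.7182818286 := exp_one_lt_d9
  have he' : 2.7182818283 < exp 1 := exp_one_gt_d9
  have hei : exp 1 * exp (-1) = 1 := by rw [← exp_add]; norm_num
  have hinv_lt : exp (-1) < 0.368 := by nlinarith [exp_pos (-1)]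
  have hinv_gt : 0.367 < exp (-1) := by nlinarith [exp_pos (-1)]
  set b := a + 1 with hb
  set l := log b
  set r := 1 - exp (-1) with hr_def
  have hr : 0 < r := by linarith
  have hb0 : 0 < b := by linarith
  have hl0 : 0 < l := by linarith
  set v := r / (b * l) with hv_def
  have hv : 0 < v := by positivity
  have hbv : b * v ≤ 0.46 := by
    have : b * v = r / l := by rw [hv_def]; field_simp
    rw [this, div_le_iff₀ hl0]
    linarith
  have hv3 : v < 1 / 3 := by nlinarith
  refine ⟨1 - v, ⟨by linarith, by linarith⟩, v, ⟨hv, hv3⟩, ?_⟩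
  have hvb : 0 < v ^ b := rpow_pos_of_pos hv b
  have htarget : exp (-1) * r ^ b / (b ^ b * l ^ a) = exp (-1) * v ^ b * l := by
    rw [hv_def, div_rpow hr.le (by positivity), mul_rpow hb0.le hl0.le, hb,
      rpow_add_one hl0.ne' a]
    field_simp
  have hexp : exp (-((1 - v) / v)) ≤ exp 1 * v ^ b := by
    have e : -((1 - v) / v) = 1 + -(b * l / r) := by
      rw [hv_def]
      field_simp
      ring
    rw [e, exp_add]
    gcongr
  have hav : 0 ≤ a * v := by positivity
  have hU := upperIncGamma_pos ha0 hav
  have hlow := upperIncGamma_le_Gamma_sub (by linarith : 1 ≤ a) hav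
  have hpow : v * (exp (-(a * v)) * ((a * v) ^ a / a)) =
      v ^ b * (exp (-(a * v)) * (a ^ a / a)) := by
    rw [mul_rpow ha0.le hv.le, hb, rpow_add_one hv.ne']
    ring
  have hmain : (exp 1 + exp (-1) * l) * Gamma a ≤ exp (-(a * v)) * (a ^ a / a) := by
    have h1 : 0.54 ≤ exp (-(a * v)) := by
      have := add_one_le_exp (-(a * v))
      nlinarith
    have h2 : 2 * a * Gamma a ≤ a ^ a / a := by
      rw [le_div_iff₀ ha0]
      linarith
    calc (exp 1 + exp (-1) * l) * Gamma a ≤ 0.54 * (2 * a) * Gamma a := by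
          gcongr
          nlinarith
      _ = 0.54 * (2 * a * Gamma a) := by ring
      _ ≤ _ := by gcongr
  have hUG : upperIncGamma a (a * v) ≤ Gamma a := by
    have : 0 ≤ exp (-(a * v)) * ((a * v) ^ a / a) := by positivity
    linarith
  rw [htarget, le_div_iff₀ hU, sub_sub_cancel]
  calc exp (-1) * v ^ b * l * upperIncGamma a (a * v)
      ≤ exp (-1) * v ^ b * l * Gamma a := by gcongr
    _ = v ^ b * ((exp 1 + exp (-1) * l) * Gamma a) - exp 1 * v ^ b * Gamma a := by ring
    _ ≤ v ^ b * (exp (-(a * v)) * (a ^ a / a)) - exp (-((1 - v) / v)) * Gamma a := by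
      gcongr
    _ = v * (exp (-(a * v)) * ((a * v) ^ a / a)) - exp (-((1 - v) / v)) * Gamma a := by
      rw [hpow]
    _ ≤ v * (Gamma a - upperIncGamma a (a * v)) - exp (-((1 - v) / v)) * Gamma a := by
      gcongr
      linarith
end

section
/- Let f_z(b) = (e^z / b)^{1/(1−b)} for b ∈ (0, 1) and z > 0. Then lim_{z → ∞} (inf_{b ∈ (0,1)} f_z(b)) / (z·e^{z+1}) = 1, i.e. the minimal value of f_z over (0,1) is asymptotic to z·e^{z+1} as z → ∞. -/
theorem rpow_one_div_one_sub_eq_exp (z : ℝ) {b : ℝ} (hb : 0 < b) :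
    (Real.exp z / b) ^ (1 / (1 - b)) = Real.exp ((z - Real.log b) / (1 - b)) := by
  rw [Real.rpow_def_of_pos (by positivity), Real.log_div (Real.exp_ne_zero z) hb.ne',
    Real.log_exp, mul_one_div]

theorem mul_exp_add_one_le_rpow {z b : ℝ} (hz : 1 ≤ z) (hb : b ∈ Set.Ioo (0 : ℝ) 1) :
    z * Real.exp (z + 1) ≤ (Real.exp z / b) ^ (1 / (1 - b)) := by
  obtain ⟨hb0, hb1⟩ := hb
  have hz0 : 0 < z := by linarith
  rw [rpow_one_div_one_sub_eq_exp z hb0]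
  nth_rewrite 1 [← Real.exp_log hz0]
  rw [← Real.exp_add, Real.exp_le_exp, le_div_iff₀ (by linarith)]
  have h := Real.log_le_sub_one_of_pos (mul_pos hz0 hb0)
  rw [Real.log_mul hz0.ne' hb0.ne'] at h
  nlinarith [mul_nonneg (Real.log_nonneg hz) hb0.le]

theorem rpow_at_inv_eq {z : ℝ} (hz : 1 < z) :
    (Real.exp z / z⁻¹) ^ (1 / (1 - z⁻¹)) =
      z * Real.exp (z + 1) * Real.exp ((1 + Real.log z) / (z - 1)) := by
  have hz0 : 0 < z := by linarith
  have hz1 : z - 1 ≠ 0 := by linarith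
  rw [rpow_one_div_one_sub_eq_exp z (inv_pos.2 hz0), Real.log_inv]
  nth_rewrite 4 [← Real.exp_log hz0]
  rw [← Real.exp_add, ← Real.exp_add]
  congr 1
  have h : 1 - z⁻¹ = (z - 1) / z := by field_simp
  rw [h]
  field_simp
  ring

theorem tendsto_one_add_log_div_sub_one :
    Filter.Tendsto (fun z : ℝ => (1 + Real.log z) / (z - 1)) Filter.atTop (nhds 0) := by
  have hlog := Real.tendsto_pow_log_div_mul_add_atTop 1 (-1) 1 one_ne_zero
  have hone := Real.tendsto_pow_log_div_mul_add_atTop 1 (-1) 0 one_ne_zero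
  refine (by simpa using hone.add hlog : Filter.Tendsto _ _ (nhds (0 : ℝ))).congr fun z => ?_
  simp only [← sub_eq_add_neg]
  ring

/-- For `f_z(b) = (e^z/b)^{1/(1−b)}` on `b ∈ (0,1)`, the minimal value of `f_z` is
asymptotic to `z·e^{z+1}` as `z → ∞`. -/
theorem stmt15 :
    Filter.Tendsto
      (fun z : ℝ =>
        sInf ((fun b : ℝ => (Real.exp z / b) ^ (1 / (1 - b))) '' Set.Ioo (0:ℝ) 1) /
          (z * Real.exp (z + 1)))
      Filter.atTop (nhds 1) := by
  have hupper := (Real.continuous_exp.tendsto 0).comp tendsto_one_add_log_div_sub_one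
  rw [Real.exp_zero] at hupper
  refine tendsto_of_tendsto_of_tendsto_of_le_of_le' tendsto_const_nhds hupper ?_ ?_
  · filter_upwards [Filter.eventually_ge_atTop 1] with z hz
    have hz0 : 0 < z := by linarith
    rw [one_le_div (by positivity)]
    refine le_csInf ((Set.nonempty_Ioo.2 one_pos).image _) ?_
    rintro _ ⟨b, hb, rfl⟩
    exact mul_exp_add_one_le_rpow hz hb
  · filter_upwards [Filter.eventually_gt_atTop 1] with z hz
    have hz0 : 0 < z := by linarith
    rw [div_le_iff₀ (by positivity), Function.comp_apply, mul_comm, ← rpow_at_inv_eq hz]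
    refine csInf_le ⟨z * Real.exp (z + 1), ?_⟩
      ⟨z⁻¹, ⟨inv_pos.2 hz0, inv_lt_one_of_one_lt₀ hz⟩, rfl⟩
    rintro _ ⟨b, hb, rfl⟩
    exact mul_exp_add_one_le_rpow hz.le hb
end

section
/- For every integer n ≥ 4 and any two nonzero linear functionals φ, ψ on ℝ^n, there exist at least two distinct vectors v, w in the set of positive roots of D_n, namely {e_i − e_j : 1 ≤ i < j ≤ n} ∪ {e_i + e_j : 1 ≤ i < j ≤ n}, such that φ(v) ≠ 0, ψ(v) ≠ 0, φ(w) ≠ 0, and ψ(w) ≠ 0. In other words, no two hyperplanes can cover all but one of the positive roots of D_n. -/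
/-- The set of positive roots of `D_n`: `{eᵢ − eⱼ : i < j} ∪ {eᵢ + eⱼ : i < j} ⊂ ℝⁿ`. -/
def posRootsD (n : ℕ) : Set (Fin n → ℝ) :=
  {x | ∃ i j : Fin n, i < j ∧
    (x = Pi.single i 1 - Pi.single j 1 ∨ x = Pi.single i 1 + Pi.single j 1)}

theorem single_add_single_mem_posRootsD {n : ℕ} {i j : Fin n} (hij : i ≠ j) :
    Pi.single i 1 + Pi.single j 1 ∈ posRootsD n := by
  rcases lt_or_gt_of_ne hij with h | h
  · exact ⟨i, j, h, Or.inr rfl⟩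
  · exact ⟨j, i, h, Or.inr (add_comm _ _)⟩

theorem single_sub_single_mem_posRootsD_or {n : ℕ} {i j : Fin n} (hij : i ≠ j) :
    Pi.single i 1 - Pi.single j 1 ∈ posRootsD n ∨
      Pi.single j 1 - Pi.single i 1 ∈ posRootsD n := by
  rcases lt_or_gt_of_ne hij with h | h
  · exact Or.inl ⟨i, j, h, Or.inl rfl⟩
  · exact Or.inr ⟨j, i, h, Or.inl rfl⟩

/-- A positive root of `D_n` has at least two nonzero coordinates. -/
theorem exists_ne_apply_ne_zero_of_mem_posRootsD {n : ℕ} {v : Fin n → ℝ}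
    (hv : v ∈ posRootsD n) (i : Fin n) : ∃ t ≠ i, v t ≠ 0 := by
  obtain ⟨k, l, hkl, hv⟩ := hv
  by_cases hki : k = i
  · refine ⟨l, fun h => hkl.ne (hki.trans h.symm), ?_⟩
    rcases hv with rfl | rfl <;> simp [hkl.ne']
  · refine ⟨k, hki, ?_⟩
    rcases hv with rfl | rfl <;> simp [hkl.ne]

/-- If `φ * ψ` vanishes on the positive roots of `D_n` not involving the coordinate `t`, then
its values at `eⱼ` and `eₘ` are opposite for distinct `j, m ≠ t`. -/
theorem apply_single_mul_add_eq_zero {n : ℕ} {φ ψ : (Fin n → ℝ) →ₗ[ℝ] ℝ} {t j m : Fin n}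
    (h : ∀ v ∈ posRootsD n, v t = 0 → φ v * ψ v = 0) (hj : j ≠ t) (hm : m ≠ t) (hjm : j ≠ m) :
    φ (Pi.single j 1) * ψ (Pi.single j 1) + φ (Pi.single m 1) * ψ (Pi.single m 1) = 0 := by
  have hadd := h _ (single_add_single_mem_posRootsD hjm) (by simp [hj.symm, hm.symm])
  rcases single_sub_single_mem_posRootsD_or hjm with hmem | hmem <;>
  · have hsub := h _ hmem (by simp [hj.symm, hm.symm])
    simp only [map_add, map_sub] at hadd hsub
    linarith

/-- For `n ≥ 4` and any two nonzero linear functionals `φ, ψ` on `ℝⁿ`, there exist at least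
two distinct positive roots of `D_n` on which both `φ` and `ψ` are nonzero: no two
hyperplanes can cover all but one of the positive roots of `D_n`. -/
theorem stmt18 (n : ℕ) (hn : 4 ≤ n) (φ ψ : (Fin n → ℝ) →ₗ[ℝ] ℝ)
    (hφ : φ ≠ 0) (hψ : ψ ≠ 0) :
    ∃ v ∈ posRootsD n, ∃ w ∈ posRootsD n, v ≠ w ∧
      φ v ≠ 0 ∧ ψ v ≠ 0 ∧ φ w ≠ 0 ∧ ψ w ≠ 0 := by
  by_contra! hcon
  have key : ∀ v ∈ posRootsD n, ∀ w ∈ posRootsD n, v ≠ w → φ v * ψ v = 0 ∨ φ w * ψ w = 0 := by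
    intro v hv w hw hvw
    by_contra! h
    exact right_ne_zero_of_mul h.2 (hcon v hv w hw hvw (left_ne_zero_of_mul h.1)
      (right_ne_zero_of_mul h.1) (left_ne_zero_of_mul h.2))
  have exists_avoid (i : Fin n) :
      ∃ t ≠ i, ∀ v ∈ posRootsD n, v t = 0 → φ v * ψ v = 0 := by
    by_cases hex : ∃ v₀ ∈ posRootsD n, φ v₀ * ψ v₀ ≠ 0
    · obtain ⟨v₀, hv₀, hne⟩ := hex
      obtain ⟨t, hti, ht⟩ := exists_ne_apply_ne_zero_of_mem_posRootsD hv₀ i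
      refine ⟨t, hti, fun v hv hvt => (key v₀ hv₀ v hv ?_).resolve_left hne⟩
      rintro rfl
      exact ht hvt
    · push Not at hex
      have : Nontrivial (Fin n) := Fin.nontrivial_iff_two_le.2 (by omega)
      obtain ⟨t, ht⟩ := exists_ne i
      exact ⟨t, ht, fun v hv _ => hex v hv⟩
  have diag (i : Fin n) : φ (Pi.single i 1) * ψ (Pi.single i 1) = 0 := by
    obtain ⟨t, hti, ht⟩ := exists_avoid i
    have hcard : 1 < (({i, t} : Finset (Fin n))ᶜ).card := by
      rw [Finset.card_compl, Fintype.card_fin, Finset.card_pair hti.symm]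
      omega
    obtain ⟨j, hj, m, hm, hjm⟩ := Finset.one_lt_card.1 hcard
    simp only [Finset.mem_compl, Finset.mem_insert, Finset.mem_singleton, not_or] at hj hm
    have hij := apply_single_mul_add_eq_zero ht hti.symm hj.2 (Ne.symm hj.1)
    have him := apply_single_mul_add_eq_zero ht hti.symm hm.2 (Ne.symm hm.1)
    have hjm := apply_single_mul_add_eq_zero ht hj.2 hm.2 hjm
    linarith
  have offDiag {i j : Fin n} (hij : i ≠ j) :
      φ (Pi.single i 1) * ψ (Pi.single j 1) + φ (Pi.single j 1) * ψ (Pi.single i 1) = 0 := by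
    have hi := diag i
    have hj := diag j
    rcases single_sub_single_mem_posRootsD_or hij with hmem | hmem
    · have hne : (Pi.single i 1 + Pi.single j 1 : Fin n → ℝ) ≠ Pi.single i 1 - Pi.single j 1 := by
        intro h
        have := congrFun h j
        norm_num [hij.symm] at this
      rcases key _ (single_add_single_mem_posRootsD hij) _ hmem hne with h | h <;>
      · simp only [map_add, map_sub] at h
        linarith
    · have hne : (Pi.single i 1 + Pi.single j 1 : Fin n → ℝ) ≠ Pi.single j 1 - Pi.single i 1 := by
        intro h
        have := congrFun h i
        norm_num [hij] at this
      rcases key _ (single_add_single_mem_posRootsD hij) _ hmem hne with h | h <;>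
      · simp only [map_add, map_sub] at h
        linarith
  obtain ⟨i, hi⟩ : ∃ i, φ (Pi.single i 1) ≠ 0 := by
    by_contra! h
    exact hφ ((Pi.basisFun ℝ (Fin n)).ext fun i => by simpa using h i)
  refine hψ ((Pi.basisFun ℝ (Fin n)).ext fun j => ?_)
  have hψi := (mul_eq_zero.1 (diag i)).resolve_left hi
  rcases eq_or_ne i j with rfl | hij
  · simpa using hψi
  · have h := offDiag hij
    rw [hψi, mul_zero, add_zero] at h
    simpa using (mul_eq_zero.1 h).resolve_left hi
end
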